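/- arXiv:1510.04050 — 2 statements merged into one kernel-verified Lean document; each statement's English description precedes it below -/
import Mathlib

section
/- Every ℵ₀-tangle τ of G satisfies exactly one of the following: (a) there is a ray R in G such that τ = {(A,B) ∈ S⃗ : B contains the vertex set of a tail of R}; (b) there are a finite set X of vertices and an ultrafilter U on 𝒞_X such that τ = {(A,B) ∈ S⃗ : there exists 𝒞 ∈ U with ⋃𝒞 ⊆ B∖A}. -/
open Set

variable {V : Type*}

/-- `{A,B}` is a separation of `G`: `A ∪ B = V` and no edge between `A∖B` and `B∖A`. -/
def IsSep (G : SimpleGraph V) (A B : Set V) : Prop :=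
  A ∪ B = Set.univ ∧ ∀ a ∈ A \ B, ∀ b ∈ B \ A, ¬ G.Adj a b

/-- A separation of finite order. -/
def IsFinSep (G : SimpleGraph V) (A B : Set V) : Prop :=
  IsSep G A B ∧ (A ∩ B).Finite

/-- The set `S⃗` of oriented finite-order separations of `G`, as ordered pairs. -/
def Svec (G : SimpleGraph V) : Set (Set V × Set V) :=
  {p | IsFinSep G p.1 p.2}

/-- `(A,B) ≤ (C,D)` iff `A ⊆ C` and `D ⊆ B`. -/
def sepLE (p q : Set V × Set V) : Prop :=
  p.1 ⊆ q.1 ∧ q.2 ⊆ p.2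

/-- An orientation of the set `S` of finite-order separations: a subset of `S⃗` containing
exactly one of `(A,B)`, `(B,A)` for every finite-order separation `{A,B}`. -/
def IsOrientation (G : SimpleGraph V) (O : Set (Set V × Set V)) : Prop :=
  O ⊆ Svec G ∧ ∀ A B : Set V, IsFinSep G A B → ((A, B) ∈ O ↔ (B, A) ∉ O)

/-- Consistency: no two distinct members `(B,A)`, `(C,D)` with `(A,B) < (C,D)`. -/
def Consistent (O : Set (Set V × Set V)) : Prop :=
  ∀ A B C D : Set V, (B, A) ∈ O → (C, D) ∈ O → (B, A) ≠ (C, D) →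
    ¬ (sepLE (A, B) (C, D) ∧ (A, B) ≠ (C, D))

/-- A star in `S⃗`: every two distinct elements point towards each other. -/
def IsStar (G : SimpleGraph V) (σ : Set (Set V × Set V)) : Prop :=
  σ ⊆ Svec G ∧ ∀ p ∈ σ, ∀ q ∈ σ, p ≠ q → sepLE p (q.2, q.1)

/-- Membership in `T_n`: a star of at most `n` elements whose target sides have finite
intersection. -/
def InTn (G : SimpleGraph V) (n : ℕ) (σ : Set (Set V × Set V)) : Prop :=
  IsStar G σ ∧ σ.Finite ∧ σ.ncard ≤ n ∧ (⋂ p ∈ σ, p.2).Finite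

/-- Membership in `T`: an arbitrary star whose target sides have finite intersection. -/
def InT (G : SimpleGraph V) (σ : Set (Set V × Set V)) : Prop :=
  IsStar G σ ∧ (⋂ p ∈ σ, p.2).Finite

/-- An `ℵ₀`-tangle of `G`: a consistent orientation of `S` with no subset in `T₃`. -/
def IsTangle (G : SimpleGraph V) (τ : Set (Set V × Set V)) : Prop :=
  IsOrientation G τ ∧ Consistent τ ∧ ∀ σ ⊆ τ, ¬ InTn G 3 σ

/-- A `T`-tangle of `S`: a consistent orientation of `S` with no subset in `T`. -/
def IsTTangle (G : SimpleGraph V) (τ : Set (Set V × Set V)) : Prop :=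
  IsOrientation G τ ∧ Consistent τ ∧ ∀ σ ⊆ τ, ¬ InT G σ

/-- The set `𝒞_X` of (vertex sets of) connected components of `G − X`. -/
def Comps (G : SimpleGraph V) (X : Set V) : Set (Set V) :=
  {C | ∃ c : (G.induce Xᶜ).ConnectedComponent, C = Subtype.val '' c.supp}

/-- A collection of subsets of `α` is an ultrafilter on `α`. -/
def IsUltra {α : Type*} (F : Set (Set α)) : Prop :=
  ∅ ∉ F ∧ (∀ s ∈ F, ∀ t ∈ F, s ∩ t ∈ F) ∧ (∀ s ∈ F, ∀ t : Set α, s ⊆ t → t ∈ F) ∧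
    ∀ s : Set α, s ∈ F ∨ sᶜ ∈ F

/-- A principal ultrafilter, generated by a single point. -/
def IsPrincipalUF {α : Type*} (F : Set (Set α)) : Prop :=
  ∃ a : α, F = {s | a ∈ s}

/-- `U(τ,X)`: the collection of all sets `𝒮` of components of `G − X` with
`(⋃(𝒞_X∖𝒮) ∪ X, ⋃𝒮 ∪ X) ∈ τ`. -/
def tangleUF (G : SimpleGraph V) (τ : Set (Set V × Set V)) (X : Set V) :
    Set (Set ↥(Comps G X)) :=
  {𝒮 | ((⋃ C ∈ 𝒮ᶜ, (C : Set V)) ∪ X, (⋃ C ∈ 𝒮, (C : Set V)) ∪ X) ∈ τ}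

/-- `f_{X',X}`: the pushforward of an ultrafilter on `𝒞_{X'}` along the map sending each
component of `G − X'` to the component of `G − X` containing it. -/
def pushUF (G : SimpleGraph V) (X X' : Set V) (F : Set (Set ↥(Comps G X'))) :
    Set (Set ↥(Comps G X)) :=
  {𝒮 | {C' : ↥(Comps G X') | ∃ C ∈ 𝒮, (C' : Set V) ⊆ (C : Set V)} ∈ F}

/-- A direction in `G`: a choice of a component of `G − X` for every finite `X ⊆ V`,
compatible under inclusion. -/
def IsDirection (G : SimpleGraph V) (f : Set V → Set V) : Prop :=
  (∀ X : Set V, X.Finite → f X ∈ Comps G X) ∧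
    ∀ X X' : Set V, X.Finite → X'.Finite → X ⊆ X' → f X' ⊆ f X

/-- A ray in `G`: a one-way infinite path. -/
def IsRay (G : SimpleGraph V) (r : ℕ → V) : Prop :=
  Function.Injective r ∧ ∀ n : ℕ, G.Adj (r n) (r (n + 1))

/-! ### Components of `G - X` -/

section Components

variable {G : SimpleGraph V} {X Y C D : Set V}

/-- `W` is closed under adjacency in `G - X`. -/
def AdjClosed (G : SimpleGraph V) (X W : Set V) : Prop :=
  ∀ a ∈ W, ∀ b ∉ X, G.Adj a b → b ∈ W

lemma AdjClosed.mono {W : Set V} (h : AdjClosed G X W) (hXY : X ⊆ Y) : AdjClosed G Y W :=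
  fun a ha b hb hab => h a ha b (fun hx => hb (hXY hx)) hab

lemma notMem_of_mem_comps (hC : C ∈ Comps G X) {a : V} (ha : a ∈ C) : a ∉ X := by
  obtain ⟨c, rfl⟩ := hC
  obtain ⟨a, -, rfl⟩ := ha
  exact a.2

lemma nonempty_of_mem_comps (hC : C ∈ Comps G X) : C.Nonempty := by
  obtain ⟨c, rfl⟩ := hC
  exact c.nonempty_supp.image _

lemma exists_mem_comps {a : V} (ha : a ∉ X) : ∃ C ∈ Comps G X, a ∈ C :=
  ⟨_, ⟨(G.induce Xᶜ).connectedComponentMk ⟨a, ha⟩, rfl⟩, ⟨a, ha⟩, rfl, rfl⟩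

lemma adjClosed_of_mem_comps (hC : C ∈ Comps G X) : AdjClosed G X C := by
  obtain ⟨c, rfl⟩ := hC
  rintro _ ⟨a, ha, rfl⟩ b hb hab
  refine ⟨⟨b, hb⟩, ?_, rfl⟩
  have hadj : (G.induce Xᶜ).Adj a ⟨b, hb⟩ := hab
  exact (SimpleGraph.ConnectedComponent.mem_supp_congr_adj c hadj).1 ha

/-- A component is contained in every adjacency-closed set which it meets. -/
lemma subset_of_mem_comps (hC : C ∈ Comps G X) {W : Set V} (hW : AdjClosed G X W)
    (hCW : (C ∩ W).Nonempty) : C ⊆ W := by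
  obtain ⟨c, rfl⟩ := hC
  obtain ⟨_, ⟨a, ha, rfl⟩, haW⟩ := hCW
  rintro _ ⟨b, hb, rfl⟩
  obtain ⟨p⟩ : (G.induce Xᶜ).Reachable a b :=
    SimpleGraph.ConnectedComponent.exact (ha.trans hb.symm)
  clear ha hb
  induction p with
  | nil => exact haW
  | @cons a b c h p ih => exact ih (hW _ haW _ b.2 h)

lemma eq_of_mem_comps (hC : C ∈ Comps G X) (hD : D ∈ Comps G X) {a : V} (haC : a ∈ C)
    (haD : a ∈ D) : C = D :=
  (subset_of_mem_comps hC (adjClosed_of_mem_comps hD) ⟨a, haC, haD⟩).antisymm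
    (subset_of_mem_comps hD (adjClosed_of_mem_comps hC) ⟨a, haD, haC⟩)

lemma adjClosed_biUnion (𝒮 : Set (Comps G X)) : AdjClosed G X (⋃ C ∈ 𝒮, (C : Set V)) := by
  intro a ha b hb hab
  simp only [mem_iUnion] at ha ⊢
  obtain ⟨C, hC, haC⟩ := ha
  exact ⟨C, hC, adjClosed_of_mem_comps C.2 a haC b hb hab⟩

lemma isFinSep_of_adjClosed {W : Set V} (hX : X.Finite) (hW : AdjClosed G X W) :
    IsFinSep G Wᶜ (W ∪ X) := by
  refine ⟨⟨by ext; simp; tauto, ?_⟩, hX.subset fun a ha => ?_⟩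
  · rintro a ⟨-, ha⟩ b ⟨-, hb⟩ hab
    exact ha (Or.inl (hW b (not_not.1 hb) a (fun h => ha (Or.inr h)) hab.symm))
  · exact ha.2.resolve_left ha.1

/-- A component of `G - X` which avoids the separator of a separation lies strictly on one of
its sides. -/
lemma subset_or_subset_of_isSep {A B : Set V} (hC : C ∈ Comps G X) (hAB : IsSep G A B)
    (hdisj : ∀ a ∈ C, a ∉ A ∩ B) : C ⊆ A \ B ∨ C ⊆ B \ A := by
  have hcl (P Q : Set V) (hPQ : IsSep G P Q) (hd : ∀ a ∈ C, a ∉ P ∩ Q) :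
      AdjClosed G X (C ∩ (P \ Q)) := by
    rintro a ⟨haC, ha⟩ b hb hab
    have hbC := adjClosed_of_mem_comps hC a haC b hb hab
    refine ⟨hbC, ?_⟩
    have hu : b ∈ P ∪ Q := hPQ.1 ▸ mem_univ b
    have hn := hd b hbC
    by_contra hbP
    have hbQ : b ∈ Q \ P := by
      simp only [mem_union, mem_inter_iff, mem_sdiff] at *
      tauto
    exact hPQ.2 a ha b hbQ hab
  obtain ⟨a, ha⟩ := nonempty_of_mem_comps hC
  have hu : a ∈ A ∪ B := hAB.1 ▸ mem_univ a
  have hn := hdisj a ha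
  by_cases haA : a ∈ A
  · exact Or.inl ((subset_of_mem_comps hC (hcl A B hAB hdisj)
      ⟨a, ha, ha, haA, fun h => hn ⟨haA, h⟩⟩).trans inter_subset_right)
  · have hBA : IsSep G B A :=
      ⟨by rw [union_comm]; exact hAB.1, fun b hb a ha h => hAB.2 a ha b hb h.symm⟩
    exact Or.inr ((subset_of_mem_comps hC (hcl B A hBA fun a ha h => hdisj a ha h.symm)
      ⟨a, ha, ha, hu.resolve_left haA, haA⟩).trans inter_subset_right)

/-- Two vertices in the same component of `G - X` are joined by a path avoiding `X`. -/
lemma exists_isPath_of_mem_comps (hC : C ∈ Comps G X) {a b : V} (ha : a ∈ C) (hb : b ∈ C) :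
    ∃ p : G.Walk a b, p.IsPath ∧ ∀ x ∈ p.support, x ∉ X := by
  classical
  have hcl : AdjClosed G X {c | ∃ p : G.Walk a c, ∀ x ∈ p.support, x ∉ X} := by
    rintro c ⟨p, hp⟩ d hd hcd
    refine ⟨p.concat hcd, fun x hx => ?_⟩
    rw [SimpleGraph.Walk.support_concat, List.mem_append, List.mem_singleton] at hx
    rcases hx with hx | rfl
    exacts [hp x hx, hd]
  obtain ⟨p, hp⟩ := subset_of_mem_comps hC hcl
    ⟨a, ha, .nil, by simpa using notMem_of_mem_comps hC ha⟩ hb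
  exact ⟨p.bypass, p.bypass_isPath, fun x hx => hp x (p.support_bypass_subset_support hx)⟩

lemma mem_of_walk {W : Set V} (hW : AdjClosed G X W) {a b : V} (p : G.Walk a b)
    (hp : ∀ x ∈ p.support, x ∉ X) (hb : b ∈ W) : a ∈ W := by
  induction p with
  | nil => exact hb
  | cons h p ih =>
    simp only [SimpleGraph.Walk.support_cons, List.mem_cons, forall_eq_or_imp] at hp
    exact hW _ (ih hp.2 hb) _ hp.1 h.symm

end Components

/-! ### Directions and rays -/

section Directions

variable {G : SimpleGraph V} {f : Set V → Set V}

lemma IsDirection.notMem (hf : IsDirection G f) {X : Set V} (hX : X.Finite) {a : V}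
    (ha : a ∈ f X) : a ∉ X :=
  notMem_of_mem_comps (hf.1 X hX) ha

lemma IsDirection.adjClosed (hf : IsDirection G f) {X : Set V} (hX : X.Finite) :
    AdjClosed G X (f X) :=
  adjClosed_of_mem_comps (hf.1 X hX)

/-- `T` is captured by `f` if it lies in `f X` for every finite `X` avoiding `T`. -/
def Captured (f : Set V → Set V) (T : Set V) : Prop :=
  ∀ X : Set V, X.Finite → Disjoint X T → T ⊆ f X

lemma IsDirection.captured (hf : IsDirection G f) {Y : Set V} (hY : Y.Finite) :
    Captured f (f Y) := by
  intro X hX hd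
  obtain ⟨a, ha⟩ := nonempty_of_mem_comps (hf.1 _ (hX.union hY))
  have haX := hf.2 _ _ hX (hX.union hY) subset_union_left ha
  have haY := hf.2 _ _ hY (hX.union hY) subset_union_right ha
  have hcl : AdjClosed G Y (f Y ∩ f X) := by
    rintro b ⟨hbY, hbX⟩ c hc hbc
    have hcY := hf.adjClosed hY b hbY c hc hbc
    exact ⟨hcY, hf.adjClosed hX b hbX c (fun h => disjoint_left.1 hd h hcY) hbc⟩
  exact (subset_of_mem_comps (hf.1 Y hY) hcl ⟨a, haY, haY, haX⟩).trans inter_subset_right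

/-- The path `l` followed by `v` ends in the part of `G - l` to which `f` points. -/
def GoodPath (G : SimpleGraph V) (f : Set V → Set V) (l : List V) (v : V) : Prop :=
  (l ++ [v]).IsChain G.Adj ∧ l.Nodup ∧ v ∈ f {x | x ∈ l}

lemma GoodPath.extend_along_path (hf : IsDirection G f) {T : Set V} (hT : Captured f T)
    {v t : V} (p : G.Walk v t) (hp : p.IsPath) (ht : t ∈ T) :
    ∀ l : List V, GoodPath G f l v → (∀ x ∈ p.support, x ∉ l) → (∀ x ∈ l, x ∉ T) → v ∉ T →
      ∃ m u, GoodPath G f (l ++ v :: m) u ∧ u ∈ T := by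
  induction p with
  | nil => exact fun l _ _ _ h => absurd ht h
  | @cons v w t h p ih =>
    intro l hl hpl hlT hvT
    rw [SimpleGraph.Walk.cons_isPath_iff] at hp
    simp only [SimpleGraph.Walk.support_cons, List.mem_cons, forall_eq_or_imp] at hpl
    have hfin : {x | x ∈ l ++ [v]}.Finite := List.finite_toSet _
    have hpl' : ∀ x ∈ p.support, x ∉ l ++ [v] := by
      intro x hx hx'
      rw [List.mem_append, List.mem_singleton] at hx'
      rcases hx' with hx' | rfl
      exacts [hpl.2 x hx hx', hp.2 hx]
    have hlT' : ∀ x ∈ l ++ [v], x ∉ T := by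
      intro x hx
      rw [List.mem_append, List.mem_singleton] at hx
      rcases hx with hx | rfl
      exacts [hlT x hx, hvT]
    have hTf : T ⊆ f {x | x ∈ l ++ [v]} := hT _ hfin (disjoint_left.2 hlT')
    have hgood : GoodPath G f (l ++ [v]) w := by
      refine ⟨?_, ?_, mem_of_walk (hf.adjClosed hfin) p hpl' (hTf ht)⟩
      · rw [List.append_assoc, List.singleton_append, List.isChain_append_cons_cons]
        exact ⟨hl.1, h, by simp⟩
      · rw [List.nodup_append]
        refine ⟨hl.2.1, by simp, ?_⟩
        rintro a ha b hb rfl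
        rw [List.mem_singleton] at hb
        exact hpl.1 (hb ▸ ha)
    by_cases hwT : w ∈ T
    · exact ⟨[], w, hgood, hwT⟩
    · obtain ⟨m, u, hmu, hu⟩ := ih hp.1 ht (l ++ [v]) hgood hpl' hlT' hwT
      exact ⟨w :: m, u, by simpa using hmu, hu⟩

lemma GoodPath.extend (hf : IsDirection G f) {T : Set V} (hT : Captured f T)
    (hne : T.Nonempty) {l : List V} {v : V} (hl : GoodPath G f l v)
    (hlT : ∀ x ∈ l ++ [v], x ∉ T) :
    ∃ m u, GoodPath G f (l ++ v :: m) u ∧ u ∈ T := by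
  obtain ⟨t, ht⟩ := hne
  have hlT' : ∀ x ∈ l, x ∉ T := fun x hx => hlT x (by simp [hx])
  have hfin : {x | x ∈ l}.Finite := List.finite_toSet _
  obtain ⟨p, hp, hpl⟩ := exists_isPath_of_mem_comps (hf.1 _ hfin) hl.2.2
    (hT _ hfin (disjoint_left.2 hlT') ht)
  exact extend_along_path hf hT p hp ht l hl hpl hlT' (hlT v (by simp))

/-- An infinite sequence of properly extending paths has a limit ray. -/
lemma exists_ray_of_extending_paths {l : ℕ → List V} {v : ℕ → V}
    (hl : ∀ k, (l k).IsChain G.Adj) (hnd : ∀ k, (l k).Nodup)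
    (hext : ∀ k, ∃ m, l (k + 1) = l k ++ v k :: m) :
    ∃ r : ℕ → V, IsRay G r ∧ ∀ k, r (l k).length = v k := by
  have hlt : ∀ k, (l k).length < (l (k + 1)).length := by
    intro k
    obtain ⟨m, hm⟩ := hext k
    simp [hm]
  have hlen : ∀ k, k ≤ (l k).length :=
    fun _ => (strictMono_nat_of_lt_succ hlt).le_apply
  have hpre : ∀ j k, j ≤ k → l j <+: l k := by
    intro j k hjk
    induction hjk with
    | refl => exact List.prefix_rfl
    | step _ ih =>
      obtain ⟨m, hm⟩ := hext _
      exact ih.trans ⟨_, hm.symm⟩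
  have hlen' (n : ℕ) : n < (l (n + 1)).length := hlen (n + 1)
  have hr : ∀ k n (h : n < (l k).length), (l k)[n] = (l (n + 1))[n]'(hlen' n) := by
    intro k n h
    rcases le_total k (n + 1) with hk | hk
    · exact (hpre _ _ hk).getElem h
    · exact ((hpre _ _ hk).getElem (hlen' n)).symm
  refine ⟨fun n => (l (n + 1))[n]'(hlen' n), ⟨fun m n hmn => ?_, fun n => ?_⟩, fun k => ?_⟩
  · have hm : m < (l (max m n + 1)).length := (le_max_left m n).trans_lt (hlen' _)
    have hn : n < (l (max m n + 1)).length := (le_max_right m n).trans_lt (hlen' _)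
    exact ((hnd _).getElem_inj_iff (hi := hm) (hj := hn)).1
      ((hr _ _ hm).trans (hmn.trans (hr _ _ hn).symm))
  · have h := (hl (n + 2)).getElem n (hlen' (n + 1))
    rwa [hr (n + 2) n] at h
  · obtain ⟨m, hm⟩ := hext k
    refine (hr (k + 1) _ (hlt k)).symm.trans ?_
    simp [hm]

/-- A ray can be made to visit captured targets that are prescribed in terms of the initial
segment traversed so far. -/
lemma IsDirection.exists_ray_through (hf : IsDirection G f) (T : List V → Set V)
    (hT : ∀ l, Captured f (T l)) (hne : ∀ l, (T l).Nonempty) (hd : ∀ l, ∀ x ∈ l, x ∉ T l)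
    {v₀ : V} (hv₀ : v₀ ∈ f ∅) :
    ∃ r : ℕ → V, IsRay G r ∧
      ∀ N, ∃ n ≥ N, ∃ l : List V, N ≤ l.length ∧ r n ∈ T l := by
  have hstep (s : {s : List V × V // GoodPath G f s.1 s.2}) :
      ∃ s' : {s : List V × V // GoodPath G f s.1 s.2},
        (∃ m, s'.1.1 = s.1.1 ++ s.1.2 :: m) ∧ s'.1.2 ∈ T (s.1.1 ++ [s.1.2]) := by
    obtain ⟨m, u, h, hu⟩ := GoodPath.extend hf (hT _) (hne _) s.2 (hd _)
    exact ⟨⟨(_, u), h⟩, ⟨m, rfl⟩, hu⟩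
  choose next hnext hmem using hstep
  let s₀ : {s : List V × V // GoodPath G f s.1 s.2} :=
    ⟨([], v₀), by simp, by simp, by simpa using hv₀⟩
  let s (k : ℕ) := next^[k] s₀
  have hs (k : ℕ) : s (k + 1) = next (s k) := Function.iterate_succ_apply' _ _ _
  have hext (k : ℕ) : ∃ m, (s (k + 1)).1.1 = (s k).1.1 ++ (s k).1.2 :: m := hs k ▸ hnext (s k)
  have hlen (k : ℕ) : k ≤ (s k).1.1.length := by
    induction k with
    | zero => exact Nat.zero_le _
    | succ k ih =>
      obtain ⟨m, hm⟩ := hext k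
      rw [hm, List.length_append, List.length_cons]
      omega
  obtain ⟨r, hr, hrv⟩ := exists_ray_of_extending_paths (G := G) (l := fun k => (s k).1.1)
    (v := fun k => (s k).1.2) (fun k => (s k).2.1.left_of_append) (fun k => (s k).2.2.1) hext
  refine ⟨r, hr, fun N => ⟨(s (N + 1)).1.1.length, by have := hlen (N + 1); omega,
    (s N).1.1 ++ [(s N).1.2], ?_, ?_⟩⟩
  · have := hlen N
    rw [List.length_append]
    omega
  · rw [hrv, hs]
    exact hmem _

lemma IsRay.eventually_notMem {r : ℕ → V} (hr : IsRay G r) {X : Set V} (hX : X.Finite) :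
    ∃ N, ∀ n ≥ N, r n ∉ X := by
  have h := hr.1.tendsto_cofinite.eventually hX.eventually_cofinite_notMem
  rw [Nat.cofinite_eq_atTop] at h
  exact Filter.eventually_atTop.1 h

lemma IsRay.tail_subset {r : ℕ → V} (hr : IsRay G r) {X W : Set V} (hW : AdjClosed G X W)
    {n : ℕ} (hn : r n ∈ W) (hX : ∀ m ≥ n, r m ∉ X) : ∀ m ≥ n, r m ∈ W := by
  intro m hm
  induction m, hm using Nat.le_induction with
  | base => exact hn
  | succ m hm ih => exact hW _ ih _ (hX _ (by omega)) (hr.2 m)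

/-- Every direction is defined by a ray. -/
theorem IsDirection.exists_ray (hf : IsDirection G f) :
    ∃ r : ℕ → V, IsRay G r ∧ ∀ X : Set V, X.Finite → ∃ n, ∀ m ≥ n, r m ∈ f X := by
  suffices h : ∃ r : ℕ → V, IsRay G r ∧ ∀ X : Set V, X.Finite → ∀ N, ∃ n ≥ N, r n ∈ f X by
    obtain ⟨r, hr, h⟩ := h
    refine ⟨r, hr, fun X hX => ?_⟩
    obtain ⟨N, hN⟩ := hr.eventually_notMem hX
    obtain ⟨n, hn, hnX⟩ := h X hX N
    exact ⟨n, hr.tail_subset (hf.adjClosed hX) hnX fun m hm => hN m (hn.trans hm)⟩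
  let D : Set V := {v | ∀ X : Set V, X.Finite → v ∉ X → v ∈ f X}
  by_cases hD : D.Finite
  · obtain ⟨v₀, hv₀⟩ := nonempty_of_mem_comps (hf.1 D hD)
    have hsep (x : V) : ∃ Y : Set V, Y.Finite ∧ (x ∉ D → x ∉ Y ∧ x ∉ f Y) := by
      by_cases hx : x ∈ D
      · exact ⟨∅, finite_empty, fun h => absurd hx h⟩
      · have hx' := hx
        simp only [D, mem_ofPred_eq, not_forall] at hx'
        obtain ⟨Y, hY, hxY, hxf⟩ := hx'
        exact ⟨Y, hY, fun _ => ⟨hxY, hxf⟩⟩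
    choose y hy hyD using hsep
    let Y (k : ℕ) : Set V := (fun Z => Z ∪ ⋃ x ∈ Z, y x)^[k] (insert v₀ D)
    have hYs (k : ℕ) : Y (k + 1) = Y k ∪ ⋃ x ∈ Y k, y x := Function.iterate_succ_apply' _ _ _
    have hYfin (k : ℕ) : (Y k).Finite := by
      induction k with
      | zero => exact hD.insert v₀
      | succ k ih => exact hYs k ▸ ih.union (ih.biUnion fun x _ => hy x)
    have hYmono : Monotone Y := monotone_nat_of_le_succ fun k => hYs k ▸ subset_union_left
    have hfmono {j k : ℕ} (h : j ≤ k) : f (Y k) ⊆ f (Y j) :=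
      hf.2 _ _ (hYfin _) (hYfin _) (hYmono h)
    have hDY : D ⊆ Y 0 := subset_insert _ _
    have hcl : AdjClosed G D (⋂ k, f (Y k)) := by
      intro a ha b hb hab
      rw [mem_iInter] at ha ⊢
      intro k
      by_contra hbk
      have hbY : b ∈ Y k := by
        by_contra h
        exact hbk (hf.adjClosed (hYfin k) a (ha k) b h hab)
      have hyY : y b ⊆ Y (k + 1) :=
        hYs k ▸ (subset_biUnion_of_mem (u := y) hbY).trans subset_union_right
      exact (hyD b hb).2 (hf.adjClosed (hy b) a
        (hf.2 _ _ (hy b) (hYfin _) hyY (ha (k + 1))) b (hyD b hb).1 hab)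
    have hempty (a : V) : ∃ k, a ∉ f (Y k) := by
      by_contra! ha
      have h := subset_of_mem_comps (hf.1 D hD) hcl
        ⟨a, hf.2 _ _ hD (hYfin 0) hDY (ha 0), mem_iInter.2 ha⟩ hv₀
      exact hf.notMem (hYfin 0) (mem_iInter.1 h 0) (mem_insert _ _)
    have hfin (l : List V) : (Y l.length ∪ {x | x ∈ l}).Finite :=
      (hYfin _).union (List.finite_toSet l)
    obtain ⟨r, hr, h⟩ := hf.exists_ray_through (fun l => f (Y l.length ∪ {x | x ∈ l}))
      (fun l => hf.captured (hfin l)) (fun l => nonempty_of_mem_comps (hf.1 _ (hfin l)))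
      (fun l x hx hx' => hf.notMem (hfin l) hx' (Or.inr hx))
      (hf.2 _ _ finite_empty hD (empty_subset _) hv₀)
    refine ⟨r, hr, fun X hX N => ?_⟩
    choose k hk using hempty
    obtain ⟨K, hK⟩ := (hX.image k).bddAbove
    have hKX : f (Y K) ⊆ f X := hf.captured (hYfin K) X hX <| disjoint_left.2 fun a ha haK =>
      hk a (hfmono (hK (mem_image_of_mem k ha)) haK)
    obtain ⟨n, hn, l, hl, hnl⟩ := h (max N K)
    exact ⟨n, (le_max_left _ _).trans hn, hKX (hfmono ((le_max_right _ _).trans hl)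
      (hf.2 _ _ (hYfin _) (hfin l) subset_union_left hnl))⟩
  · obtain ⟨v₀, hv₀⟩ := nonempty_of_mem_comps (hf.1 ∅ finite_empty)
    obtain ⟨r, hr, h⟩ := hf.exists_ray_through (fun l => D \ {x | x ∈ l})
      (fun l X hX hd v hv => hv.1 X hX fun hvX => disjoint_left.1 hd hvX hv)
      (fun l => (Set.Infinite.sdiff hD (List.finite_toSet l)).nonempty)
      (fun l x hx hx' => hx'.2 hx) hv₀
    refine ⟨r, hr, fun X hX N => ?_⟩
    obtain ⟨M, hM⟩ := hr.eventually_notMem hX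
    obtain ⟨n, hn, l, -, hnl⟩ := h (max N M)
    exact ⟨n, (le_max_left _ _).trans hn, hnl.1 X hX (hM n ((le_max_right _ _).trans hn))⟩

end Directions

/-! ### Tangles -/

section Tangles

variable {G : SimpleGraph V} {τ : Set (Set V × Set V)} {A B A' B' : Set V}

lemma IsFinSep.symm (h : IsFinSep G A B) : IsFinSep G B A :=
  ⟨⟨by rw [union_comm]; exact h.1.1, fun b hb a ha hab => h.1.2 a ha b hb hab.symm⟩,
    by rw [inter_comm]; exact h.2⟩

lemma IsFinSep.union_inter (h : IsFinSep G A B) (h' : IsFinSep G A' B') :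
    IsFinSep G (A ∪ A') (B ∩ B') := by
  have hu (a : V) : a ∈ A ∨ a ∈ B := by
    rw [← mem_union, h.1.1]
    trivial
  have hu' (a : V) : a ∈ A' ∨ a ∈ B' := by
    rw [← mem_union, h'.1.1]
    trivial
  refine ⟨⟨?_, ?_⟩, (h.2.union h'.2).subset ?_⟩
  · ext a
    have := hu a
    have := hu' a
    simp only [mem_union, mem_inter_iff, mem_univ, iff_true]
    tauto
  · rintro a ⟨-, ha⟩ b ⟨⟨hbB, hbB'⟩, hb⟩ hab
    rw [mem_union, not_or] at hb
    by_cases haB : a ∈ B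
    · have haB' : a ∉ B' := fun h => ha ⟨haB, h⟩
      exact h'.1.2 a ⟨(hu' a).resolve_right haB', haB'⟩ b ⟨hbB', hb.2⟩ hab
    · exact h.1.2 a ⟨(hu a).resolve_right haB, haB⟩ b ⟨hbB, hb.1⟩ hab
  · intro a ha
    simp only [mem_union, mem_inter_iff] at ha ⊢
    tauto

lemma IsTangle.isFinSep (hτ : IsTangle G τ) (h : (A, B) ∈ τ) : IsFinSep G A B :=
  hτ.1.1 h

lemma IsTangle.mem_or_mem (hτ : IsTangle G τ) (h : IsFinSep G A B) :
    (A, B) ∈ τ ∨ (B, A) ∈ τ := by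
  have := hτ.1.2 A B h
  tauto

lemma IsTangle.infinite (hτ : IsTangle G τ) (h : (A, B) ∈ τ) : B.Infinite := by
  intro hB
  refine hτ.2.2 {(A, B)} (by simpa using h) ⟨⟨?_, ?_⟩, finite_singleton _, ?_, ?_⟩
  · simpa using hτ.1.1 h
  · rintro p rfl q rfl hpq
    exact absurd rfl hpq
  · simp
  · simpa using hB

lemma IsTangle.mem_of_sepLE (hτ : IsTangle G τ) (h : (A, B) ∈ τ) (h' : IsFinSep G A' B')
    (hle : sepLE (A', B') (A, B)) : (A', B') ∈ τ := by
  by_contra hn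
  have hmem := (hτ.mem_or_mem h').resolve_left hn
  refine hτ.2.1 A' B' A B hmem h (fun heq => ?_) ⟨hle, fun heq => hn (heq ▸ h)⟩
  rw [Prod.mk.injEq] at heq
  refine hτ.infinite hmem (h'.2.subset fun a ha => ⟨ha, ?_⟩)
  rw [heq.1]
  exact hle.1 ha

lemma IsTangle.union_inter_mem (hτ : IsTangle G τ) (h : (A, B) ∈ τ) (h' : (A', B') ∈ τ) :
    (A ∪ A', B ∩ B') ∈ τ := by
  have hs := hτ.isFinSep h
  have hs' := hτ.isFinSep h'
  have hcorner : (A' ∩ B, B' ∪ A) ∈ τ :=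
    hτ.mem_of_sepLE h' (hs'.symm.union_inter hs).symm ⟨inter_subset_left, subset_union_left⟩
  refine (hτ.mem_or_mem (hs.union_inter hs')).resolve_right fun hn => ?_
  have hsub : ({(A, B), (A' ∩ B, B' ∪ A), (B ∩ B', A ∪ A')} : Set (Set V × Set V)) ⊆ τ := by
    rintro p (rfl | rfl | rfl) <;> assumption
  refine hτ.2.2 _ hsub ⟨⟨hsub.trans hτ.1.1, ?_⟩, by simp, ?_, ?_⟩
  · rintro p (rfl | rfl | rfl) q (rfl | rfl | rfl) hpq <;>
      first
      | exact absurd rfl hpq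
      | (constructor <;> intro a <;> simp only [mem_union, mem_inter_iff] <;> tauto)
  · refine (ncard_insert_le _ _).trans (Nat.succ_le_succ ((ncard_insert_le _ _).trans ?_))
    simp
  · refine (hs.2.union hs'.2).subset fun a ha => ?_
    simp only [mem_insert_iff, mem_singleton_iff, iInter_iInter_eq_or_left, iInter_iInter_eq_left,
      mem_inter_iff, mem_union] at ha ⊢
    tauto

lemma IsTangle.inter_infinite (hτ : IsTangle G τ) (h : (A, B) ∈ τ) (h' : (A', B') ∈ τ) :
    (B ∩ B').Infinite :=
  hτ.infinite (hτ.union_inter_mem h h')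

/-- Membership in a tangle is monotone in the large side, up to finite sets. -/
lemma IsTangle.mem_of_diff_finite (hτ : IsTangle G τ) (h : (A, B) ∈ τ) (h' : IsFinSep G A' B')
    (hfin : (B \ B').Finite) : (A', B') ∈ τ := by
  refine (hτ.mem_or_mem h').resolve_right fun hn => hτ.inter_infinite h hn ?_
  refine (hfin.union h'.2).subset fun a ha => ?_
  by_cases hB' : a ∈ B'
  exacts [Or.inr ⟨ha.2, hB'⟩, Or.inl ⟨ha.1, hB'⟩]

/-- The sets of components of `G - X` towards which `τ` points. -/
def pointedComps (G : SimpleGraph V) (τ : Set (Set V × Set V)) (X : Set V) :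
    Set (Set (Comps G X)) :=
  {𝒮 | ((⋃ C ∈ 𝒮, (C : Set V))ᶜ, (⋃ C ∈ 𝒮, (C : Set V)) ∪ X) ∈ τ}

lemma IsTangle.isUltra_pointedComps (hτ : IsTangle G τ) {X : Set V} (hX : X.Finite) :
    IsUltra (pointedComps G τ X) := by
  have hsep (𝒮 : Set (Comps G X)) := isFinSep_of_adjClosed hX (adjClosed_biUnion 𝒮)
  refine ⟨fun h => ?_, fun s hs t ht => ?_, fun s hs t hst => ?_, fun s => ?_⟩
  · exact hτ.infinite h (by simpa using hX)
  · refine hτ.mem_of_diff_finite (hτ.union_inter_mem hs ht) (hsep _) (hX.subset ?_)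
    rintro a ⟨⟨has, hat⟩, ha⟩
    by_contra haX
    have has := has.resolve_right haX
    have hat := hat.resolve_right haX
    simp only [mem_iUnion] at has hat
    obtain ⟨C, hC, haC⟩ := has
    obtain ⟨D, hD, haD⟩ := hat
    obtain rfl : C = D := Subtype.ext (eq_of_mem_comps C.2 D.2 haC haD)
    exact ha (Or.inl (mem_biUnion (show C ∈ s ∩ t from ⟨hC, hD⟩) haC))
  · refine hτ.mem_of_diff_finite hs (hsep _) (finite_empty.subset ?_)
    rw [sdiff_subset_iff, union_empty]
    exact union_subset_union_left _ (biUnion_subset_biUnion_left hst)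
  · refine (hτ.mem_or_mem (hsep s)).imp_right fun h =>
      hτ.mem_of_diff_finite h (hsep _) (finite_empty.subset ?_)
    rintro a ⟨has, ha⟩
    refine ha ?_
    by_cases haX : a ∈ X
    · exact Or.inr haX
    · obtain ⟨C, hC, haC⟩ := exists_mem_comps (G := G) haX
      refine Or.inl (mem_biUnion (x := ⟨C, hC⟩) (fun hCs => has ?_) haC)
      exact mem_biUnion hCs haC

/-- If `τ` does not point to a single component of `G - X`, then it is induced by the ultrafilter
of sets of components to which it points. -/
lemma IsTangle.eq_of_nonprincipal (hτ : IsTangle G τ) {X : Set V} (hX : X.Finite)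
    (hnp : ∀ C ∈ Comps G X, (Cᶜ, C ∪ X) ∉ τ) :
    τ = {p : Set V × Set V | p ∈ Svec G ∧
      ∃ 𝒮 ∈ pointedComps G τ X, (⋃ C ∈ 𝒮, (C : Set V)) ⊆ p.2 \ p.1} := by
  obtain ⟨hempty, hinter, hsup, hcompl⟩ := hτ.isUltra_pointedComps hX
  have havoid (x : V) : {C : Comps G X | x ∉ (C : Set V)} ∈ pointedComps G τ X := by
    refine (hcompl {C : Comps G X | x ∈ (C : Set V)}).resolve_left fun h => ?_
    by_cases hx : ∃ C : Comps G X, x ∈ (C : Set V)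
    · obtain ⟨C, hC⟩ := hx
      have heq : {C : Comps G X | x ∈ (C : Set V)} = {C} := by
        ext D
        exact ⟨fun hD => Subtype.ext (eq_of_mem_comps D.2 C.2 hD hC), fun hD => hD ▸ hC⟩
      rw [heq] at h
      refine hnp C C.2 ?_
      rwa [← biUnion_singleton C (fun D : Comps G X => (D : Set V))]
    · refine hempty ?_
      convert h
      symm
      exact eq_empty_of_forall_notMem fun C hC => hx ⟨C, hC⟩
  have havoids (F : Set V) (hF : F.Finite) :
      {C : Comps G X | ∀ x ∈ F, x ∉ (C : Set V)} ∈ pointedComps G τ X := by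
    induction F, hF using Set.Finite.induction_on with
    | empty => exact hsup _ ((hcompl ∅).resolve_left hempty) _ fun C _ x hx => hx.elim
    | @insert x F _ _ ih =>
      refine hsup _ (hinter _ (havoid x) _ ih) _ ?_
      rintro C ⟨hxC, hFC⟩ z (rfl | hz)
      exacts [hxC, hFC z hz]
  ext ⟨A, B⟩
  constructor
  · intro h
    have hs := hτ.isFinSep h
    refine ⟨hs, {C | (C : Set V) ⊆ B \ A}, ?_, iUnion₂_subset fun C hC => hC⟩
    refine (hcompl _).resolve_right fun hc => ?_
    refine hτ.inter_infinite h (hinter _ hc _ (havoids _ hs.2)) (hX.subset ?_)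
    rintro a ⟨haB, ha⟩
    refine ha.resolve_left fun ha => ?_
    simp only [mem_iUnion] at ha
    obtain ⟨C, ⟨hCc, hCF⟩, haC⟩ := ha
    rcases subset_or_subset_of_isSep C.2 hs.1 (fun x hxC hx => hCF x hx hxC) with hA | hB
    exacts [(hA haC).2 haB, hCc hB]
  · rintro ⟨hs, 𝒮, h𝒮, hsub⟩
    refine hτ.mem_of_diff_finite h𝒮 hs (hX.subset ?_)
    rintro a ⟨ha, haB⟩
    exact ha.resolve_left fun h => haB (hsub h).1

/-- If `τ` points to the component `f X` of `G - X` for every finite `X`, then it is induced by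
a ray. -/
lemma IsTangle.exists_ray (hτ : IsTangle G τ) {f : Set V → Set V}
    (hf : ∀ X : Set V, X.Finite → f X ∈ Comps G X ∧ ((f X)ᶜ, f X ∪ X) ∈ τ) :
    ∃ r : ℕ → V, IsRay G r ∧
      τ = {p : Set V × Set V | p ∈ Svec G ∧ ∃ n : ℕ, ∀ m ≥ n, r m ∈ p.2} := by
  have hdir : IsDirection G f := by
    refine ⟨fun X hX => (hf X hX).1, fun X X' hX hX' hXX' => ?_⟩
    obtain ⟨a, ⟨haX, haX'⟩, ha⟩ :=
      ((hτ.inter_infinite (hf X hX).2 (hf X' hX').2).sdiff hX').nonempty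
    exact subset_of_mem_comps (hf X' hX').1 ((adjClosed_of_mem_comps (hf X hX).1).mono hXX')
      ⟨a, haX'.resolve_right ha, haX.resolve_right fun h => ha (hXX' h)⟩
  obtain ⟨r, hr, htail⟩ := hdir.exists_ray
  have htail_mem (A B : Set V) (h : (A, B) ∈ τ) : ∃ n, ∀ m ≥ n, r m ∈ B := by
    have hs := hτ.isFinSep h
    obtain ⟨hC, hCτ⟩ := hf _ hs.2
    have hCB : f (A ∩ B) ⊆ B \ A := by
      refine (subset_or_subset_of_isSep hC hs.1 fun a ha =>
        notMem_of_mem_comps hC ha).resolve_left fun hA => hτ.inter_infinite h hCτ ?_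
      exact hs.2.subset fun a ha => ha.2.resolve_left fun haC => (hA haC).2 ha.1
    obtain ⟨n, hn⟩ := htail _ hs.2
    exact ⟨n, fun m hm => (hCB (hn m hm)).1⟩
  refine ⟨r, hr, ?_⟩
  ext ⟨A, B⟩
  refine ⟨fun h => ⟨hτ.1.1 h, htail_mem A B h⟩, ?_⟩
  rintro ⟨hs : IsFinSep G A B, n, hn⟩
  refine (hτ.mem_or_mem hs).resolve_right fun h => ?_
  obtain ⟨k, hk⟩ := htail_mem B A h
  obtain ⟨N, hN⟩ := hr.eventually_notMem hs.2
  exact hN (max N (max n k)) (by omega) ⟨hk _ (by omega), hn _ (by omega)⟩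

/-- No tangle is induced both by a ray and by an ultrafilter of components. -/
lemma IsTangle.not_ray_and_ultra (hτ : IsTangle G τ) {r : ℕ → V} (hr : IsRay G r)
    (hrτ : τ = {p : Set V × Set V | p ∈ Svec G ∧ ∃ n : ℕ, ∀ m ≥ n, r m ∈ p.2})
    {X : Set V} (hX : X.Finite) {U : Set (Set (Comps G X))} (hU : IsUltra U)
    (hUτ : τ = {p : Set V × Set V | p ∈ Svec G ∧
      ∃ 𝒮 ∈ U, (⋃ C ∈ 𝒮, (C : Set V)) ⊆ p.2 \ p.1}) : False := by
  obtain ⟨N, hN⟩ := hr.eventually_notMem hX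
  obtain ⟨C, hC, hNC⟩ := exists_mem_comps (G := G) (hN N le_rfl)
  have hcl := adjClosed_of_mem_comps hC
  have hCτ : (Cᶜ, C ∪ X) ∈ τ := by
    rw [hrτ]
    exact ⟨isFinSep_of_adjClosed hX hcl, N, fun m hm => Or.inl (hr.tail_subset hcl hNC hN m hm)⟩
  have hvτ : ({r N}, univ) ∈ τ := by
    have hs : IsFinSep G {r N} univ := ⟨⟨by simp, by simp⟩, by simp⟩
    exact (hτ.mem_or_mem hs).resolve_right fun h => hτ.infinite h (finite_singleton _)
  rw [hUτ] at hCτ hvτ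
  obtain ⟨-, 𝒮, h𝒮, hsub⟩ := hCτ
  obtain ⟨-, 𝒯, h𝒯, hsub'⟩ := hvτ
  refine hU.1 ?_
  convert hU.2.1 _ h𝒮 _ h𝒯
  symm
  refine eq_empty_of_forall_notMem ?_
  rintro D ⟨hD𝒮, hD𝒯⟩
  obtain ⟨a, ha⟩ := nonempty_of_mem_comps D.2
  have haC : a ∈ C := not_not.1 (hsub (mem_biUnion hD𝒮 ha)).2
  have hDC := eq_of_mem_comps D.2 hC ha haC
  exact (hsub' (mem_biUnion hD𝒯 (show r N ∈ (D : Set V) from hDC ▸ hNC))).2 rfl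

end Tangles

/-- Theorem 3.5: every `ℵ₀`-tangle `τ` satisfies exactly one of:
(a) for some ray `R`, `τ` consists of the separations whose right side contains a tail
of `R`; (b) for some finite `X` and ultrafilter `U` on `𝒞_X`, `τ` consists of the
separations `(A,B)` with `⋃𝒞 ⊆ B∖A` for some `𝒞 ∈ U`. -/
theorem stmt14 [Infinite V] (G : SimpleGraph V) (τ : Set (Set V × Set V))
    (hτ : IsTangle G τ) :
    Xor'
      (∃ r : ℕ → V, IsRay G r ∧
        τ = {p : Set V × Set V | p ∈ Svec G ∧ ∃ n : ℕ, ∀ m ≥ n, r m ∈ p.2})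
      (∃ (X : Set V) (_ : X.Finite) (U : Set (Set ↥(Comps G X))), IsUltra U ∧
        τ = {p : Set V × Set V | p ∈ Svec G ∧
          ∃ 𝒮 ∈ U, (⋃ C ∈ 𝒮, (C : Set V)) ⊆ p.2 \ p.1}) := by
  by_cases h : ∃ X : Set V, X.Finite ∧ ∀ C ∈ Comps G X, (Cᶜ, C ∪ X) ∉ τ
  · obtain ⟨X, hX, hnp⟩ := h
    have hU := hτ.isUltra_pointedComps hX
    have hUτ := hτ.eq_of_nonprincipal hX hnp
    refine Or.inr ⟨⟨X, hX, _, hU, hUτ⟩, ?_⟩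
    rintro ⟨r, hr, hrτ⟩
    exact hτ.not_ray_and_ultra hr hrτ hX hU hUτ
  · push Not at h
    have hex (X : Set V) : ∃ C, X.Finite → C ∈ Comps G X ∧ (Cᶜ, C ∪ X) ∈ τ := by
      by_cases hX : X.Finite
      · obtain ⟨C, hC⟩ := h X hX
        exact ⟨C, fun _ => hC⟩
      · exact ⟨∅, fun h => absurd h hX⟩
    choose f hf using hex
    obtain ⟨r, hr, hrτ⟩ := hτ.exists_ray hf
    refine Or.inl ⟨⟨r, hr, hrτ⟩, ?_⟩
    rintro ⟨X, hX, U, hU, hUτ⟩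
    exact hτ.not_ray_and_ultra hr hrτ hX hU hUτ
end

section
/- Let X be a finite set of vertices of G and U an ultrafilter on 𝒞_X which is not the principal ultrafilter generated by {C} for any component C of G − X with finite vertex set. Then there exists an ℵ₀-tangle τ of G with U(τ,X) = U. -/
open Set

variable {V : Type*}

/-- Distinct components of `G − X` are disjoint. -/
theorem Comps.eq_of_mem {G : SimpleGraph V} {X C D : Set V} (hC : C ∈ Comps G X)
    (hD : D ∈ Comps G X) {v : V} (hvC : v ∈ C) (hvD : v ∈ D) : C = D := by
  obtain ⟨c, rfl⟩ := hC
  obtain ⟨d, rfl⟩ := hD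
  obtain ⟨x, hx, rfl⟩ := hvC
  obtain ⟨y, hy, hxy⟩ := hvD
  obtain rfl := Subtype.ext hxy
  rw [SimpleGraph.ConnectedComponent.mem_supp_iff] at hx hy
  rw [← hx, ← hy]

theorem Comps.disjoint_base {G : SimpleGraph V} {X C : Set V} (hC : C ∈ Comps G X)
    {v : V} (hv : v ∈ C) : v ∉ X := by
  obtain ⟨c, rfl⟩ := hC
  obtain ⟨x, -, rfl⟩ := hv
  exact x.2

theorem Comps.exists_mem (G : SimpleGraph V) {X : Set V} {v : V} (hv : v ∉ X) :
    ∃ C : ↥(Comps G X), v ∈ (C : Set V) :=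
  ⟨⟨_, (G.induce Xᶜ).connectedComponentMk ⟨v, hv⟩, rfl⟩, ⟨v, hv⟩, rfl, rfl⟩

/-- Adjacent vertices outside `X` lie in the same component of `G − X`. -/
theorem Comps.mem_of_adj {G : SimpleGraph V} {X C : Set V} (hC : C ∈ Comps G X)
    {v w : V} (hv : v ∈ C) (hw : w ∉ X) (hvw : G.Adj v w) : w ∈ C := by
  obtain ⟨c, rfl⟩ := hC
  obtain ⟨x, hx, rfl⟩ := hv
  refine ⟨⟨w, hw⟩, ?_, rfl⟩
  rw [SimpleGraph.ConnectedComponent.mem_supp_iff] at hx ⊢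
  rw [← hx, SimpleGraph.ConnectedComponent.eq]
  exact SimpleGraph.Adj.reachable (G := G.induce Xᶜ) hvw.symm

/-- The components in `𝒮` and those outside `𝒮`, with `X` added to each, meet only in `X`. -/
theorem Comps.inter_biUnion_compl (G : SimpleGraph V) (X : Set V) (𝒮 : Set ↥(Comps G X)) :
    ((⋃ C ∈ 𝒮ᶜ, (C : Set V)) ∪ X) ∩ ((⋃ C ∈ 𝒮, (C : Set V)) ∪ X) ⊆ X := by
  rintro v ⟨hv | hv, hv' | hv'⟩ <;> try assumption
  simp only [mem_iUnion] at hv hv'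
  obtain ⟨C, hC, hvC⟩ := hv
  obtain ⟨D, hD, hvD⟩ := hv'
  obtain rfl : C = D := Subtype.ext (Comps.eq_of_mem C.2 D.2 hvC hvD)
  exact absurd hD hC

theorem Comps.isFinSep (G : SimpleGraph V) {X : Set V} (hX : X.Finite)
    (𝒮 : Set ↥(Comps G X)) :
    IsFinSep G ((⋃ C ∈ 𝒮ᶜ, (C : Set V)) ∪ X) ((⋃ C ∈ 𝒮, (C : Set V)) ∪ X) := by
  refine ⟨⟨?_, ?_⟩, hX.subset (Comps.inter_biUnion_compl G X 𝒮)⟩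
  · refine eq_univ_of_forall fun v => ?_
    by_cases hv : v ∈ X
    · exact Or.inl (Or.inr hv)
    obtain ⟨C, hC⟩ := Comps.exists_mem G hv
    by_cases hCS : C ∈ 𝒮
    · exact Or.inr (Or.inl (mem_biUnion hCS hC))
    · exact Or.inl (Or.inl (mem_biUnion (s := 𝒮ᶜ) hCS hC))
  · rintro a ⟨ha | ha, ha'⟩ b ⟨hb, hb'⟩ hab
    · simp only [mem_iUnion] at ha
      obtain ⟨C, hC, haC⟩ := ha
      have hbX : b ∉ X := fun h => hb' (Or.inr h)
      exact hb' (Or.inl (mem_biUnion hC (Comps.mem_of_adj C.2 haC hbX hab)))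
    · exact ha' (Or.inr ha)

theorem IsUltra.univ_mem {α : Type*} {F : Set (Set α)} (hF : IsUltra F) : univ ∈ F := by
  rcases hF.2.2.2 univ with h | h
  · exact h
  · exact absurd (compl_univ ▸ h) hF.1

theorem IsUltra.compl_notMem_iff {α : Type*} {F : Set (Set α)} (hF : IsUltra F) (s : Set α) :
    sᶜ ∉ F ↔ s ∈ F := by
  refine ⟨(hF.2.2.2 s).resolve_right, fun h h' => hF.1 ?_⟩
  rw [← inter_compl_self s]
  exact hF.2.1 s h _ h'

/-- An ultrafilter containing a finite set is principal at one of its points. -/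
theorem IsUltra.exists_principal_of_finite {α : Type*} {F : Set (Set α)} (hF : IsUltra F)
    {s : Set α} (hs : s ∈ F) (hfin : s.Finite) : ∃ a ∈ s, F = {t | a ∈ t} := by
  let f : Filter α :=
    { sets := F
      univ_sets := hF.univ_mem
      sets_of_superset := fun h h' => hF.2.2.1 _ h _ h'
      inter_sets := fun h h' => hF.2.1 _ h _ h' }
  let u : Ultrafilter α := Ultrafilter.ofComplNotMemIff f hF.compl_notMem_iff
  obtain ⟨a, ha, hu⟩ := Ultrafilter.eq_pure_of_finite_mem (f := u) hfin hs
  refine ⟨a, ha, ?_⟩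
  ext t
  change t ∈ u ↔ a ∈ t
  rw [hu, Ultrafilter.mem_pure]

/-- A nonprincipal ultrafilter on `V` induces a tangle by pointing to the large side. -/
theorem isTangle_of_ultrafilter (G : SimpleGraph V) (W : Ultrafilter V)
    (hW : ∀ s ∈ W, s.Infinite) : IsTangle G {p | p ∈ Svec G ∧ p.2 ∈ W} := by
  refine ⟨⟨fun p hp => hp.1, fun A B hAB => ⟨?_, ?_⟩⟩, ?_, ?_⟩
  · rintro ⟨-, hB⟩ ⟨-, hA⟩
    exact hW _ (W.inter_sets hA hB) hAB.2
  · intro h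
    refine ⟨hAB, ?_⟩
    have hAB' : A ∪ B ∈ W := hAB.1.1 ▸ Filter.univ_mem
    refine (Ultrafilter.union_mem_iff.1 hAB').resolve_left fun hA => h ⟨?_, hA⟩
    exact ⟨⟨union_comm B A ▸ hAB.1.1, fun b hb a ha hba => hAB.1.2 a ha b hb hba.symm⟩,
      inter_comm B A ▸ hAB.2⟩
  · rintro A B C D ⟨-, hA⟩ ⟨hCD, hD⟩ - ⟨⟨hAC, -⟩, -⟩
    exact hW _ (W.inter_sets (W.sets_of_superset hA hAC) hD) hCD.2
  · rintro σ hσ ⟨-, hfin, -, hinter⟩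
    exact hW _ ((Filter.biInter_mem hfin).2 fun p hp => (hσ hp).2) hinter

/-- If every `⋃ 𝒮` with `𝒮 ∈ F` is infinite, some nonprincipal ultrafilter contains them all. -/
theorem IsUltra.exists_ultrafilter_biUnion {ι : Type*} {F : Set (Set ι)} (hF : IsUltra F)
    (c : ι → Set V) (hinf : ∀ 𝒮 ∈ F, (⋃ i ∈ 𝒮, c i).Infinite) :
    ∃ W : Ultrafilter V, (∀ s ∈ W, s.Infinite) ∧ ∀ 𝒮 ∈ F, (⋃ i ∈ 𝒮, c i) ∈ W := by
  let f : Filter V :=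
    { sets := {s | ∃ 𝒮 ∈ F, ((⋃ i ∈ 𝒮, c i) \ s).Finite}
      univ_sets := ⟨univ, hF.univ_mem, by simp⟩
      sets_of_superset := by
        rintro s t ⟨𝒮, h𝒮, hs⟩ hst
        exact ⟨𝒮, h𝒮, hs.subset (sdiff_subset_sdiff_right hst)⟩
      inter_sets := by
        rintro s t ⟨𝒮, h𝒮, hs⟩ ⟨𝒯, h𝒯, ht⟩
        refine ⟨𝒮 ∩ 𝒯, hF.2.1 _ h𝒮 _ h𝒯, (hs.union ht).subset ?_⟩
        rw [sdiff_inter]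
        exact union_subset_union
          (sdiff_subset_sdiff_left (biUnion_mono inter_subset_left fun _ _ => subset_rfl))
          (sdiff_subset_sdiff_left (biUnion_mono inter_subset_right fun _ _ => subset_rfl)) }
  have hf : f.NeBot := by
    rw [← Filter.empty_mem_iff_bot.not.trans Filter.neBot_iff.symm]
    rintro ⟨𝒮, h𝒮, hfin⟩
    exact hinf 𝒮 h𝒮 (by simpa using hfin)
  have hle : (Ultrafilter.of f : Filter V) ≤ f := Ultrafilter.of_le f
  refine ⟨Ultrafilter.of f, fun s hs hfin => ?_, fun 𝒮 h𝒮 => hle ⟨𝒮, h𝒮, by simp⟩⟩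
  refine Ultrafilter.compl_mem_iff_notMem.1 (hle ?_) hs
  exact ⟨univ, hF.univ_mem, hfin.subset fun v hv => not_not.1 hv.2⟩

/-- Lemma 3.7: every ultrafilter on `𝒞_X` not generated by a finite
component of `G − X` is `U(τ,X)` for some `ℵ₀`-tangle `τ`. -/
theorem stmt16 [Infinite V] (G : SimpleGraph V) (X : Set V) (hX : X.Finite)
    (U : Set (Set ↥(Comps G X))) (hU : IsUltra U)
    (h : ¬ ∃ C : ↥(Comps G X), (C : Set V).Finite ∧
        U = {𝒮 : Set ↥(Comps G X) | C ∈ 𝒮}) :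
    ∃ τ : Set (Set V × Set V), IsTangle G τ ∧ tangleUF G τ X = U := by
  have hinf : ∀ 𝒮 ∈ U, (⋃ C ∈ 𝒮, (C : Set V)).Infinite := by
    intro 𝒮 h𝒮 hfin
    have h𝒮fin : 𝒮.Finite := by
      refine Finite.of_finite_image (hfin.finite_subsets.subset ?_) Subtype.val_injective.injOn
      rintro _ ⟨C, hC, rfl⟩
      exact subset_biUnion_of_mem (u := fun C : ↥(Comps G X) => (C : Set V)) hC
    obtain ⟨C, hC, hUC⟩ := hU.exists_principal_of_finite h𝒮 h𝒮fin
    exact h ⟨C, hfin.subset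
      (subset_biUnion_of_mem (u := fun C : ↥(Comps G X) => (C : Set V)) hC), hUC⟩
  obtain ⟨W, hW, hUW⟩ := hU.exists_ultrafilter_biUnion _ hinf
  refine ⟨_, isTangle_of_ultrafilter G W hW, ?_⟩
  ext 𝒮
  refine ⟨fun hτ => ?_, fun h𝒮 => ?_⟩
  · rw [← hU.compl_notMem_iff]
    intro hc
    have hA := W.sets_of_superset (hUW _ hc) (subset_union_left (t := X))
    exact hW _ (W.inter_sets hA hτ.2) (hX.subset (Comps.inter_biUnion_compl G X 𝒮))
  · exact ⟨Comps.isFinSep G hX 𝒮, W.sets_of_superset (hUW _ h𝒮) subset_union_left⟩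
end
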